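/- Define Si(x) = ∫₀^x (sin t)/t dt and Ci(x) = −∫_x^∞ (cos t)/t dt (the latter as lim_{T→∞} of ∫_x^T), and let V₂(s) = (1/π²)(1 + γ + log(2πs)) − (1/π²)[cos(2πs) + Ci(2πs) + 2πs·(Si(2πs) − π/2)]. Let δ : ℕ → ℝ be a sequence satisfying: (a) δ(ℓ) + 1/(2π²ℓ²) + (3/(2π⁴ℓ⁴))·(log(2πℓ) + γ − 11/6) = o(ℓ⁻⁴) as ℓ → ∞; (b) δ(0) + 2·∑_{ℓ=1}^∞ δ(ℓ) = 0; (c) ∑_{ℓ=1}^∞ ℓ·(δ(ℓ) + 1/(2π²ℓ²)) = 1/12 − log(2π)/(2π²). Define W(L) = L·δ(0) + 2·∑_{ℓ=1}^{L−1} (L − ℓ)·δ(ℓ). Then, as L → ∞ along positive integers, V₂(L) − W(L) = 1/6 + (1/(2π⁴L²))·(log(2πL) + γ − (π² + 9)/6) + o(L⁻²). -/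

import Mathlib

open Real Filter Asymptotics

theorem isLittleO_inv_pow_of_sub_succ {a : ℕ → ℝ} {k : ℕ} (hk : 1 ≤ k)
    (ha : Tendsto a atTop (nhds 0))
    (h : (fun n : ℕ => a n - a (n + 1)) =o[atTop] fun n : ℕ => ((n : ℝ) ^ (k + 1))⁻¹) :
    a =o[atTop] fun n : ℕ => ((n : ℝ) ^ k)⁻¹ := by
  have step : ∀ n : ℕ, 1 ≤ n →
      ((n : ℝ) ^ (k + 1))⁻¹ ≤ 2 * (((n : ℝ) ^ k)⁻¹ - (((n + 1 : ℕ) : ℝ) ^ k)⁻¹) := by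
    intro n hn
    have hn' : (1 : ℝ) ≤ n := by exact_mod_cast hn
    have h1 : (n : ℝ) ^ k * (n + 1) ≤ (n : ℝ) * (n + 1) ^ k := by
      obtain ⟨j, rfl⟩ := Nat.exists_eq_add_of_le' hk
      have : (n : ℝ) ^ j ≤ (n + 1) ^ j := by gcongr; linarith
      calc (n : ℝ) ^ (j + 1) * (n + 1) = n * (n + 1) * n ^ j := by ring
        _ ≤ n * (n + 1) * (n + 1) ^ j := by gcongr
        _ = _ := by ring
    have h2 : (((n : ℝ) + 1) ^ k)⁻¹ ≤ n / (n ^ k * (n + 1)) := by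
      rw [inv_eq_one_div, div_le_div_iff₀ (by positivity) (by positivity)]
      linarith
    have h3 : ((n : ℝ) ^ k)⁻¹ - n / (n ^ k * (n + 1)) = 1 / (n ^ k * (n + 1)) := by
      field_simp; ring
    have h4 : ((n : ℝ) ^ (k + 1))⁻¹ ≤ 2 * (1 / (n ^ k * (n + 1))) := by
      rw [pow_succ, inv_eq_one_div, mul_one_div, div_le_div_iff₀ (by positivity) (by positivity)]
      have : 0 < (n : ℝ) ^ k := by positivity
      nlinarith
    push_cast
    linarith
  have lim : Tendsto (fun n : ℕ => ((n : ℝ) ^ k)⁻¹) atTop (nhds 0) :=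
    tendsto_inv_atTop_zero.comp ((tendsto_pow_atTop (by lia)).comp tendsto_natCast_atTop_atTop)
  have one_sided : ∀ (b : ℕ → ℝ) (ε : ℝ) (N : ℕ), Tendsto b atTop (nhds 0) → 0 < ε → 1 ≤ N →
      (∀ n ≥ N, b n - b (n + 1) ≤ ε * ((n : ℝ) ^ (k + 1))⁻¹) →
      ∀ n ≥ N, b n ≤ 2 * ε * ((n : ℝ) ^ k)⁻¹ := by
    intro b ε N hb hε hN hstep n hn
    have hlim : Tendsto (fun m : ℕ => b m - 2 * ε * ((m : ℝ) ^ k)⁻¹) atTop (nhds 0) := by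
      simpa using hb.sub (lim.const_mul (2 * ε))
    have hmono : ∀ m ≥ n, b n - 2 * ε * ((n : ℝ) ^ k)⁻¹ ≤ b m - 2 * ε * ((m : ℝ) ^ k)⁻¹ := by
      intro m hm
      induction m, hm using Nat.le_induction with
      | base => exact le_rfl
      | succ m hm ih =>
        have h1 := hstep m (le_trans hn hm)
        have h2 := mul_le_mul_of_nonneg_left (step m (hN.trans (le_trans hn hm))) hε.le
        linarith
    have := ge_of_tendsto hlim (eventually_atTop.2 ⟨n, hmono⟩)
    linarith
  rw [isLittleO_iff] at h ⊢
  intro c hc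
  obtain ⟨N, hN⟩ := eventually_atTop.1 (h (half_pos hc))
  filter_upwards [eventually_ge_atTop (max N 1)] with n hn
  have hb : ∀ m ≥ max N 1, |a m - a (m + 1)| ≤ c / 2 * ((m : ℝ) ^ (k + 1))⁻¹ := by
    intro m hm
    have := hN m (le_trans (le_max_left _ _) hm)
    rwa [norm_eq_abs, norm_eq_abs, abs_of_nonneg (by positivity : 0 ≤ ((m : ℝ) ^ (k + 1))⁻¹)]
      at this
  have h1 := one_sided a (c / 2) _ ha (half_pos hc) (le_max_right _ _)
    (fun m hm => (le_abs_self _).trans (hb m hm)) n hn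
  have h2 := one_sided (fun m => -a m) (c / 2) _ (by simpa using ha.neg) (half_pos hc)
    (le_max_right _ _) (fun m hm => by
      have := neg_le_of_abs_le (hb m hm); linarith) n hn
  rw [norm_eq_abs, norm_eq_abs, abs_of_nonneg (by positivity : 0 ≤ ((n : ℝ) ^ k)⁻¹), abs_le]
  constructor <;> linarith

theorem tendsto_integral_sin_div :
    Tendsto (fun T : ℝ => ∫ t in (0 : ℝ)..T, sin t / t) atTop (nhds (π / 2)) := by
  have inner : ∀ t : ℝ, 0 < t → ∫ s in Set.Ioi (0 : ℝ), exp (-t * s) = 1 / t := by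
    intro t ht
    rw [integral_exp_mul_Ioi (by linarith) 0]
    simp
  have inner' : ∀ T s : ℝ, ∫ t in (0 : ℝ)..T, sin t * exp (-t * s) =
      (1 - exp (-T * s) * (s * sin T + cos T)) / (1 + s ^ 2) := by
    intro T s
    have hs : (1 + s ^ 2) ≠ 0 := by positivity
    rw [intervalIntegral.integral_eq_sub_of_hasDerivAt
      (f := fun t => -(exp (-t * s) * (s * sin t + cos t)) / (1 + s ^ 2))]
    · simp; field_simp; ring
    · intro t _
      have h1 : HasDerivAt (fun t : ℝ => exp (-t * s)) (exp (-t * s) * (-1 * s)) t :=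
        ((hasDerivAt_id t).neg.mul_const s).exp
      have h2 := (h1.mul (((hasDerivAt_sin t).const_mul s).add (hasDerivAt_cos t))).neg.div_const
        (1 + s ^ 2)
      refine h2.congr_deriv ?_
      simp only [Pi.add_apply]
      field_simp; ring
    · exact (by fun_prop : Continuous fun t => sin t * exp (-t * s)).intervalIntegrable _ _
  have swap : ∀ T : ℝ, 0 < T → ∫ t in (0 : ℝ)..T, sin t / t =
      ∫ s in Set.Ioi (0 : ℝ), (1 - exp (-T * s) * (s * sin T + cos T)) / (1 + s ^ 2) := by
    intro T hT
    have hint : MeasureTheory.Integrable (Function.uncurry fun t s : ℝ => sin t * exp (-t * s))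
        ((MeasureTheory.volume.restrict (Set.Ioc 0 T)).prod
          (MeasureTheory.volume.restrict (Set.Ioi 0))) := by
      rw [MeasureTheory.integrable_prod_iff]
      · constructor
        · filter_upwards [MeasureTheory.ae_restrict_mem measurableSet_Ioc] with t ht
          change MeasureTheory.Integrable (fun s => sin t * exp (-t * s)) _
          exact (integrableOn_exp_mul_Ioi (neg_lt_zero.2 ht.1) 0).const_mul _
        · have hb : MeasureTheory.Integrable (fun _ : ℝ => (1 : ℝ))
            (MeasureTheory.volume.restrict (Set.Ioc 0 T)) := by
              exact MeasureTheory.integrable_const _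
          refine hb.mono' ?_ ?_
          · exact (MeasureTheory.AEStronglyMeasurable.norm (by
              exact (by fun_prop : Continuous (Function.uncurry fun t s : ℝ =>
                sin t * exp (-t * s))).aestronglyMeasurable)).integral_prod_right'
          · filter_upwards [MeasureTheory.ae_restrict_mem measurableSet_Ioc] with t ht
            simp only [Function.uncurry, norm_mul, norm_eq_abs, abs_exp]
            rw [MeasureTheory.integral_const_mul, inner t ht.1, abs_mul, abs_abs,
              abs_of_pos (by have := ht.1; positivity : 0 < 1 / t), mul_one_div,
              div_le_one ht.1]
            exact abs_sin_le_abs.trans (abs_of_pos ht.1).le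
      · exact (by fun_prop : Continuous (Function.uncurry fun t s : ℝ =>
          sin t * exp (-t * s))).aestronglyMeasurable
    rw [intervalIntegral.integral_of_le hT.le]
    calc ∫ t in Set.Ioc 0 T, sin t / t
        = ∫ t in Set.Ioc 0 T, ∫ s in Set.Ioi (0 : ℝ), sin t * exp (-t * s) := by
          refine MeasureTheory.setIntegral_congr_fun measurableSet_Ioc fun t ht => ?_
          simp only [MeasureTheory.integral_const_mul, inner t ht.1, mul_one_div]
      _ = ∫ s in Set.Ioi (0 : ℝ), ∫ t in Set.Ioc 0 T, sin t * exp (-t * s) :=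
          MeasureTheory.integral_integral_swap hint
      _ = _ := by
          refine MeasureTheory.integral_congr_ae (Eventually.of_forall fun s => ?_)
          simp only [← intervalIntegral.integral_of_le hT.le, inner']
  have hval : π / 2 = ∫ s in Set.Ioi (0 : ℝ), (1 + s ^ 2)⁻¹ := by
    rw [integral_Ioi_inv_one_add_sq]; simp
  rw [hval]
  refine Tendsto.congr' ((eventually_gt_atTop 0).mono fun T hT => (swap T hT).symm) ?_
  refine MeasureTheory.tendsto_integral_filter_of_dominated_convergence
    (fun s => 2 * (1 + s ^ 2)⁻¹) ?_ ?_ ?_ ?_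
  · refine Eventually.of_forall fun T => Continuous.aestronglyMeasurable ?_
    have : ∀ s : ℝ, 1 + s ^ 2 ≠ 0 := fun s => by positivity
    fun_prop (disch := assumption)
  · filter_upwards [eventually_ge_atTop 1] with T hT
    filter_upwards [MeasureTheory.ae_restrict_mem measurableSet_Ioi] with s hs
    have hs : 0 < s := hs
    have hs2 : 0 < 1 + s ^ 2 := by positivity
    rw [norm_eq_abs, abs_div, abs_of_pos hs2, div_eq_mul_inv]
    gcongr
    have h1 : |s * sin T + cos T| ≤ s + 1 := by
      refine (abs_add_le _ _).trans (add_le_add ?_ (abs_cos_le_one T))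
      rw [abs_mul, abs_of_pos hs]
      exact mul_le_of_le_one_right hs.le (abs_sin_le_one T)
    have h2 : exp (-T * s) * (s + 1) ≤ 1 := by
      calc exp (-T * s) * (s + 1) ≤ exp (-s) * exp s := by
            gcongr
            · nlinarith
            · exact add_one_le_exp s
        _ = 1 := by rw [← exp_add]; simp
    calc |1 - exp (-T * s) * (s * sin T + cos T)|
        ≤ |1| + |exp (-T * s) * (s * sin T + cos T)| := abs_sub _ _
      _ ≤ 1 + exp (-T * s) * (s + 1) := by
          rw [abs_one, abs_mul, abs_exp]; gcongr
      _ ≤ 2 := by linarith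
  · exact (integrable_inv_one_add_sq.const_mul 2).integrableOn
  · filter_upwards [MeasureTheory.ae_restrict_mem measurableSet_Ioi] with s hs
    have hs : 0 < s := hs
    have h0 : Tendsto (fun T : ℝ => exp (-T * s)) atTop (nhds 0) := by
      refine tendsto_exp_atBot.comp ?_
      exact tendsto_neg_atTop_atBot.atBot_mul_const hs
    have h1 : Tendsto (fun T : ℝ => exp (-T * s) * (s * sin T + cos T)) atTop (nhds 0) := by
      refine squeeze_zero_norm (fun T => ?_) (by simpa only [zero_mul] using h0.mul_const (s + 1))
      rw [norm_mul, norm_eq_abs, norm_eq_abs, abs_exp]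
      refine mul_le_mul_of_nonneg_left ?_ (exp_pos _).le
      refine (abs_add_le _ _).trans (add_le_add ?_ (abs_cos_le_one T))
      rw [abs_mul, abs_of_pos hs]
      exact mul_le_of_le_one_right hs.le (abs_sin_le_one T)
    simpa using (h1.const_sub 1).div_const (1 + s ^ 2)

theorem abs_add_le_of_tendsto_integral {f e P : ℝ → ℝ} {K x I : ℝ} {n : ℕ} (hx : 0 < x)
    (hK : 0 ≤ K) (hf : ContinuousOn f (Set.Ioi 0)) (he : ContinuousOn e (Set.Ioi 0))
    (hP : ∀ t, 0 < t → HasDerivAt P (f t - e t) t)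
    (hbound : ∀ t, 0 < t → |e t| ≤ K * n / t ^ (n + 1))
    (hlim : Tendsto P atTop (nhds 0))
    (hI : Tendsto (fun T : ℝ => ∫ t in x..T, f t) atTop (nhds I)) :
    |I + P x| ≤ K / x ^ n := by
  have key : ∀ T, x ≤ T → |(∫ t in x..T, f t) + P x - P T| ≤ K / x ^ n := by
    intro T hT
    have hsub : Set.uIcc x T ⊆ Set.Ioi 0 := by
      rw [Set.uIcc_of_le hT]; exact fun t ht => hx.trans_le ht.1
    have hfi : IntervalIntegrable f MeasureTheory.volume x T :=
      (hf.mono hsub).intervalIntegrable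
    have hei : IntervalIntegrable e MeasureTheory.volume x T :=
      (he.mono hsub).intervalIntegrable
    have h1 : ∫ t in x..T, (f t - e t) = P T - P x :=
      intervalIntegral.integral_eq_sub_of_hasDerivAt (fun t ht => hP t (hsub ht)) (hfi.sub hei)
    rw [intervalIntegral.integral_sub hfi hei] at h1
    have hbc : ContinuousOn (fun t : ℝ => K * n / t ^ (n + 1)) (Set.uIcc x T) :=
      continuousOn_const.div (by fun_prop) fun t ht => (pow_pos (hsub ht) _).ne'
    have h2 : ∫ t in x..T, K * n / t ^ (n + 1) = -(K / T ^ n) - -(K / x ^ n) := by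
      refine intervalIntegral.integral_eq_sub_of_hasDerivAt
        (f := fun t : ℝ => -(K / t ^ n)) (fun t ht => ?_) hbc.intervalIntegrable
      have ht0 : t ≠ 0 := (hsub ht).ne'
      have := ((hasDerivAt_const t K).div (hasDerivAt_pow n t) (pow_ne_zero n ht0)).neg
      refine this.congr_deriv ?_
      rcases n with _ | n
      · simp
      · simp only [Nat.add_sub_cancel]
        field_simp
        ring
    have h3 : ‖∫ t in x..T, e t‖ ≤ ∫ t in x..T, K * n / t ^ (n + 1) :=
      intervalIntegral.norm_integral_le_of_norm_le hT
        (Eventually.of_forall fun t ht => hbound t (hx.trans ht.1)) hbc.intervalIntegrable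
    have h4 : 0 ≤ K / T ^ n := div_nonneg hK (pow_nonneg (hx.le.trans hT) n)
    have h5 : (∫ t in x..T, f t) + P x - P T = ∫ t in x..T, e t := by linarith
    rw [h5, ← norm_eq_abs]
    linarith
  have hT : Tendsto (fun T => |(∫ t in x..T, f t) + P x - P T|) atTop (nhds |I + P x|) := by
    simpa using ((hI.add_const (P x)).sub hlim).abs
  exact le_of_tendsto hT ((eventually_ge_atTop x).mono key)

theorem tendsto_div_pow_of_abs_le {g : ℝ → ℝ} {C : ℝ} {n : ℕ} (hn : n ≠ 0)
    (hg : ∀ t, |g t| ≤ C) : Tendsto (fun t => g t / t ^ n) atTop (nhds 0) := by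
  have h : Tendsto (fun t : ℝ => C / t ^ n) atTop (nhds 0) :=
    tendsto_const_nhds.div_atTop (tendsto_pow_atTop hn)
  refine squeeze_zero_norm' ?_ h
  filter_upwards [eventually_gt_atTop 0] with t ht
  rw [norm_eq_abs, abs_div, abs_of_pos (pow_pos ht n)]
  gcongr
  exact hg t

theorem hasDerivAt_div_pow {g : ℝ → ℝ} {g' t : ℝ} (n : ℕ) (ht : t ≠ 0) (hg : HasDerivAt g g' t) :
    HasDerivAt (fun t => g t / t ^ n) (g' / t ^ n - n * g t / t ^ (n + 1)) t := by
  refine (hg.div (hasDerivAt_pow n t) (pow_ne_zero n ht)).congr_deriv ?_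
  rcases n with _ | n
  · simp
  · simp only [Nat.add_sub_cancel]
    field_simp
    ring

theorem abs_integral_cos_div_sub_le {x I : ℝ} (hx : 0 < x) (hsin : sin x = 0) (hcos : cos x = 1)
    (hI : Tendsto (fun T : ℝ => ∫ t in x..T, cos t / t) atTop (nhds I)) :
    |I - 1 / x ^ 2| ≤ 2 / x ^ 3 := by
  have h := abs_add_le_of_tendsto_integral (f := fun t => cos t / t)
    (e := fun t => -(6 * sin t / t ^ 4))
    (P := fun t => sin t / t ^ 1 + -cos t / t ^ 2 + -2 * sin t / t ^ 3) (K := 2) (n := 3) hx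
    (by norm_num) (continuous_cos.continuousOn.div continuousOn_id fun t ht => ne_of_gt ht)
    (ContinuousOn.neg (ContinuousOn.div (by fun_prop) (by fun_prop)
      fun t ht => (pow_pos ht 4).ne'))
    (fun t ht => ?_) (fun t ht => ?_) ?_ hI
  · simp only [hsin, hcos] at h
    convert h using 2
    ring
  · refine (((hasDerivAt_div_pow 1 ht.ne' (hasDerivAt_sin t)).add
      (hasDerivAt_div_pow 2 ht.ne' (hasDerivAt_cos t).neg)).add
      (hasDerivAt_div_pow 3 ht.ne' ((hasDerivAt_sin t).const_mul (-2)))).congr_deriv ?_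
    push_cast
    simp only [Pi.neg_apply]
    field_simp
    ring
  · rw [abs_neg, abs_div, abs_of_pos (pow_pos ht 4), abs_mul]
    norm_num
    gcongr
    linarith [abs_sin_le_one t]
  · have h1 := tendsto_div_pow_of_abs_le one_ne_zero abs_sin_le_one
    have h2 := tendsto_div_pow_of_abs_le (g := fun t => -cos t) two_ne_zero
      fun t => by rw [abs_neg]; exact abs_cos_le_one t
    have h3 := tendsto_div_pow_of_abs_le (g := fun t => -2 * sin t) (C := 2) three_ne_zero
      fun t => by rw [abs_mul]; norm_num; linarith [abs_sin_le_one t]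
    simpa using (h1.add h2).add h3

theorem abs_integral_sin_div_sub_le {x I : ℝ} (hx : 0 < x) (hsin : sin x = 0) (hcos : cos x = 1)
    (hI : Tendsto (fun T : ℝ => ∫ t in x..T, sin t / t) atTop (nhds I)) :
    |I - 1 / x + 2 / x ^ 3| ≤ 6 / x ^ 4 := by
  have h := abs_add_le_of_tendsto_integral (f := fun t => sin t / t)
    (e := fun t => 24 * sin t / t ^ 5)
    (P := fun t => -cos t / t ^ 1 + -sin t / t ^ 2 + 2 * cos t / t ^ 3 + 6 * sin t / t ^ 4)
    (K := 6) (n := 4) hx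
    (by norm_num) (continuous_sin.continuousOn.div continuousOn_id fun t ht => ne_of_gt ht)
    (ContinuousOn.div (by fun_prop) (by fun_prop) fun t ht => (pow_pos ht 5).ne')
    (fun t ht => ?_) (fun t ht => ?_) ?_ hI
  · simp only [hsin, hcos] at h
    convert h using 2
    ring
  · refine ((((hasDerivAt_div_pow 1 ht.ne' (hasDerivAt_cos t).neg).add
      (hasDerivAt_div_pow 2 ht.ne' (hasDerivAt_sin t).neg)).add
      (hasDerivAt_div_pow 3 ht.ne' ((hasDerivAt_cos t).const_mul 2))).add
      (hasDerivAt_div_pow 4 ht.ne' ((hasDerivAt_sin t).const_mul 6))).congr_deriv ?_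
    push_cast
    simp only [Pi.neg_apply]
    field_simp
    ring
  · rw [abs_div, abs_of_pos (pow_pos ht 5), abs_mul]
    norm_num
    gcongr
    linarith [abs_sin_le_one t]
  · have h1 := tendsto_div_pow_of_abs_le (g := fun t => -cos t) one_ne_zero
      fun t => by rw [abs_neg]; exact abs_cos_le_one t
    have h2 := tendsto_div_pow_of_abs_le (g := fun t => -sin t) two_ne_zero
      fun t => by rw [abs_neg]; exact abs_sin_le_one t
    have h3 := tendsto_div_pow_of_abs_le (g := fun t => 2 * cos t) (C := 2) three_ne_zero
      fun t => by rw [abs_mul]; norm_num; linarith [abs_cos_le_one t]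
    have h4 := tendsto_div_pow_of_abs_le (g := fun t => 6 * sin t) (C := 6) four_ne_zero
      fun t => by rw [abs_mul]; norm_num; linarith [abs_sin_le_one t]
    simpa using ((h1.add h2).add h3).add h4

theorem abs_log_one_add_sub_le {u : ℝ} (hu : |u| ≤ 1 / 2) :
    |log (1 + u) - (u - u ^ 2 / 2 + u ^ 3 / 3 - u ^ 4 / 4)| ≤ 2 * |u| ^ 5 := by
  have h := abs_log_sub_add_sum_range_le (x := -u) (by rw [abs_neg]; linarith) 4
  simp only [Finset.sum_range_succ, Finset.sum_range_zero, abs_neg, sub_neg_eq_add] at h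
  have h2 : |u| ^ (4 + 1) / (1 - |u|) ≤ 2 * |u| ^ 5 := by
    rw [div_le_iff₀ (by linarith)]
    calc |u| ^ (4 + 1) = 2 * |u| ^ 5 * (1 / 2) := by ring
      _ ≤ 2 * |u| ^ 5 * (1 - |u|) := by gcongr; linarith
  refine le_trans (le_of_eq ?_) (h.trans h2)
  congr 1
  push_cast
  ring

theorem tendsto_log_one_add_add_log_one_sub :
    Tendsto (fun u : ℝ => (log (1 + u) + log (1 - u) + u ^ 2) / u ^ 4) (nhdsWithin 0 (Set.Ioi 0))
      (nhds (-1 / 2)) := by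
  rw [tendsto_iff_norm_sub_tendsto_zero]
  have h0 : Tendsto (fun u : ℝ => 4 * u) (nhdsWithin 0 (Set.Ioi 0)) (nhds 0) := by
    have : Continuous fun u : ℝ => 4 * u := by fun_prop
    simpa using (this.tendsto 0).mono_left nhdsWithin_le_nhds
  refine squeeze_zero' (Eventually.of_forall fun _ => norm_nonneg _) ?_ h0
  filter_upwards [Ioc_mem_nhdsGT (by norm_num : (0 : ℝ) < 1 / 2)] with u hu
  have hu0 : 0 < u := hu.1
  have h1 := abs_log_one_add_sub_le (u := u) (by rw [abs_of_pos hu0]; exact hu.2)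
  have h2 := abs_log_one_add_sub_le (u := -u) (by rw [abs_neg, abs_of_pos hu0]; exact hu.2)
  rw [abs_neg, ← sub_eq_add_neg] at h2
  rw [abs_of_pos hu0] at h1 h2
  have h3 : (log (1 + u) + log (1 - u) + u ^ 2) / u ^ 4 - -1 / 2 =
      ((log (1 + u) - (u - u ^ 2 / 2 + u ^ 3 / 3 - u ^ 4 / 4)) +
      (log (1 - u) - (-u - (-u) ^ 2 / 2 + (-u) ^ 3 / 3 - (-u) ^ 4 / 4))) / u ^ 4 := by
    field_simp; ring
  rw [h3, norm_eq_abs, abs_div, abs_of_pos (pow_pos hu0 4), div_le_iff₀ (pow_pos hu0 4)]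
  refine (abs_add_le _ _).trans ?_
  nlinarith

theorem tendsto_log_one_add_sub_log_one_sub :
    Tendsto (fun u : ℝ => (log (1 + u) - log (1 - u)) / u) (nhdsWithin 0 (Set.Ioi 0))
      (nhds 2) := by
  have h : HasDerivAt (fun u : ℝ => log (1 + u) - log (1 - u)) 2 0 := by
    have h1 : HasDerivAt (fun u : ℝ => log (1 + u)) (1 / (1 + 0)) 0 :=
      ((hasDerivAt_id (0 : ℝ)).const_add 1).log (by norm_num)
    have h2 : HasDerivAt (fun u : ℝ => log (1 - u)) (-1 / (1 - 0)) 0 :=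
      ((hasDerivAt_id (0 : ℝ)).const_sub 1).log (by norm_num)
    exact (h1.sub h2).congr_deriv (by norm_num)
  have := h.tendsto_slope_zero_right
  refine this.congr fun u => ?_
  simp [div_eq_inv_mul]

/-- The second difference of `A + log n / π² - (log n + c) / (2π⁴n²)`, to order `n⁻⁴`. -/
theorem tendsto_second_difference_log (A c : ℝ) (F : ℕ → ℝ)
    (hF : ∀ n : ℕ, 1 ≤ n → F n = A + 1 / π ^ 2 * log n -
      1 / (2 * π ^ 4) * ((log n + c) / (n : ℝ) ^ 2)) :
    Tendsto (fun n : ℕ => ((n + 1 : ℕ) : ℝ) ^ 4 * (F n - 2 * F (n + 1) + F (n + 2))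
      + ((n + 1 : ℕ) : ℝ) ^ 2 / π ^ 2 + 3 / π ^ 4 * (log (n + 1 : ℕ) + c)) atTop
      (nhds (-1 / (2 * π ^ 2) + 5 / (2 * π ^ 4))) := by
  have hL : Tendsto (fun n : ℕ => ((n + 1 : ℕ) : ℝ)) atTop atTop :=
    tendsto_natCast_atTop_atTop.comp (tendsto_add_atTop_nat 1)
  have hu : Tendsto (fun n : ℕ => (((n + 1 : ℕ) : ℝ))⁻¹) atTop (nhdsWithin 0 (Set.Ioi 0)) :=
    tendsto_inv_atTop_nhdsGT_zero.comp hL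
  have hu0 : Tendsto (fun n : ℕ => (((n + 1 : ℕ) : ℝ))⁻¹) atTop (nhds 0) :=
    hu.mono_right nhdsWithin_le_nhds
  have hlog : Tendsto (fun n : ℕ => (log ((n + 1 : ℕ) : ℝ) + c) * (((n + 1 : ℕ) : ℝ))⁻¹)
      atTop (nhds 0) := by
    have h1 : Tendsto (fun x : ℝ => log x / x) atTop (nhds 0) := by
      simpa using tendsto_pow_log_div_mul_add_atTop 1 0 1 one_ne_zero
    have := (h1.comp hL).add (hu0.const_mul c)
    simp only [mul_zero, add_zero] at this
    refine this.congr fun n => ?_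
    simp only [Function.comp]
    ring
  have hS := tendsto_log_one_add_add_log_one_sub.comp hu
  have hD := tendsto_log_one_add_sub_log_one_sub.comp hu
  have hcore : Tendsto (fun n : ℕ =>
      1 / π ^ 2 * ((log (1 + ((n + 1 : ℕ) : ℝ)⁻¹) + log (1 - ((n + 1 : ℕ) : ℝ)⁻¹)
        + ((n + 1 : ℕ) : ℝ)⁻¹ ^ 2) / ((n + 1 : ℕ) : ℝ)⁻¹ ^ 4)
      - 1 / (2 * π ^ 4) * ((((log ((n + 1 : ℕ) : ℝ) + c) * (((n + 1 : ℕ) : ℝ))⁻¹) *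
          (((n + 1 : ℕ) : ℝ))⁻¹ * (10 - 6 * ((n + 1 : ℕ) : ℝ)⁻¹ ^ 2)
        + (1 + ((n + 1 : ℕ) : ℝ)⁻¹ ^ 2) * (((log (1 + ((n + 1 : ℕ) : ℝ)⁻¹)
          + log (1 - ((n + 1 : ℕ) : ℝ)⁻¹)
        + ((n + 1 : ℕ) : ℝ)⁻¹ ^ 2) / ((n + 1 : ℕ) : ℝ)⁻¹ ^ 4) * ((n + 1 : ℕ) : ℝ)⁻¹ ^ 2 - 1)
        - 2 * ((log (1 + ((n + 1 : ℕ) : ℝ)⁻¹) - log (1 - ((n + 1 : ℕ) : ℝ)⁻¹))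
          / ((n + 1 : ℕ) : ℝ)⁻¹))
        / (1 - ((n + 1 : ℕ) : ℝ)⁻¹ ^ 2) ^ 2)) atTop
      (nhds (1 / π ^ 2 * (-1 / 2) - 1 / (2 * π ^ 4) * ((0 * 0 * (10 - 6 * 0 ^ 2)
        + (1 + 0 ^ 2) * (-1 / 2 * 0 ^ 2 - 1) - 2 * 2) / (1 - 0 ^ 2) ^ 2))) := by
    refine (hS.const_mul _).sub (Tendsto.const_mul _ (Tendsto.div ?_ ?_ (by norm_num)))
    · exact (((hlog.mul hu0).mul (((hu0.pow 2).const_mul 6).const_sub 10)).add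
        (((hu0.pow 2).const_add 1).mul ((hS.mul (hu0.pow 2)).sub_const 1))).sub (hD.const_mul 2)
    · exact ((hu0.pow 2).const_sub 1).pow 2
  have hval : 1 / π ^ 2 * (-1 / 2) - 1 / (2 * π ^ 4) * ((0 * 0 * (10 - 6 * 0 ^ 2)
        + (1 + 0 ^ 2) * (-1 / 2 * 0 ^ 2 - 1) - 2 * 2) / (1 - 0 ^ 2) ^ 2)
        = -1 / (2 * π ^ 2) + 5 / (2 * π ^ 4) := by
    ring
  rw [hval] at hcore
  refine hcore.congr' ?_
  filter_upwards [eventually_ge_atTop 1] with n hn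
  have hn1 : (1 : ℝ) ≤ n := by exact_mod_cast hn
  rw [hF n hn, hF (n + 1) (by lia), hF (n + 2) (by lia)]
  have e1 : (n : ℝ) = ((n + 1 : ℕ) : ℝ) * (1 - (((n + 1 : ℕ) : ℝ))⁻¹) := by
    push_cast; field_simp; ring
  have e2 : ((n + 2 : ℕ) : ℝ) = ((n + 1 : ℕ) : ℝ) * (1 + (((n + 1 : ℕ) : ℝ))⁻¹) := by
    push_cast; field_simp; ring
  have hx : (2 : ℝ) ≤ ((n + 1 : ℕ) : ℝ) := by push_cast; linarith
  rw [e2]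
  rw [show log (n : ℝ) = _ from congrArg log e1, show (n : ℝ) ^ 2 = _ from congrArg (· ^ 2) e1]
  generalize ((n + 1 : ℕ) : ℝ) = x at hx
  have hx0 : 0 < x := by linarith
  have hxi : x⁻¹ < 1 := by rw [inv_lt_one₀ hx0]; linarith
  have hxi0 : 0 < x⁻¹ := inv_pos.2 hx0
  have hm : 1 - x⁻¹ ≠ 0 := by linarith
  have hp : 1 + x⁻¹ ≠ 0 := by linarith
  rw [log_mul hx0.ne' hm, log_mul hx0.ne' hp]
  generalize log (1 - x⁻¹) = lm
  generalize log (1 + x⁻¹) = lp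
  generalize log x = l
  have hu' : 1 - x⁻¹ ^ 2 ≠ 0 := by
    rw [show 1 - x⁻¹ ^ 2 = (1 - x⁻¹) * (1 + x⁻¹) by ring]; exact mul_ne_zero hm hp
  obtain ⟨u, rfl⟩ : ∃ u, x = u⁻¹ := ⟨x⁻¹, (inv_inv x).symm⟩
  rw [inv_inv] at *
  have hu1 : u ≠ 0 := hxi0.ne'
  rw [show 1 - u ^ 2 = (1 - u) * (1 + u) by ring] at *
  have hpi := pi_ne_zero
  field_simp
  ring

theorem abs_number_variance_sub_le (Si Ci V : ℝ → ℝ)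
    (hSi : ∀ x : ℝ, Si x = ∫ t in (0 : ℝ)..x, Real.sin t / t)
    (hCi : ∀ x : ℝ, 0 < x →
      Tendsto (fun T : ℝ => ∫ t in x..T, Real.cos t / t) atTop (nhds (-Ci x)))
    (hV : ∀ s : ℝ, 0 < s →
      V s = (1 / π ^ 2) * (1 + Real.eulerMascheroniConstant + Real.log (2 * π * s))
        - (1 / π ^ 2) * (Real.cos (2 * π * s) + Ci (2 * π * s)
            + 2 * π * s * (Si (2 * π * s) - π / 2))) {L : ℕ} (hL : 1 ≤ L) :
    |V L - ((1 / π ^ 2) * (1 + Real.eulerMascheroniConstant + Real.log (2 * π * L))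
      - (1 / π ^ 2) * (1 / (2 * π * L) ^ 2))| ≤ (1 / π ^ 2) * (8 / (2 * π * L) ^ 3) := by
  have hL0 : (0 : ℝ) < L := by exact_mod_cast hL
  rw [hV L hL0]
  have hx : 0 < 2 * π * (L : ℝ) := by positivity
  have hcos : cos (2 * π * L) = 1 := by
    rw [mul_comm]; exact cos_nat_mul_two_pi L
  have hsin : sin (2 * π * L) = 0 := by
    have := sin_nat_mul_pi (2 * L)
    rw [← this]; congr 1; push_cast; ring
  generalize 2 * π * (L : ℝ) = x at *
  have hc := abs_integral_cos_div_sub_le hx hsin hcos (hCi x hx)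
  have hlim : Tendsto (fun T : ℝ => ∫ t in x..T, sin t / t) atTop (nhds (π / 2 - Si x)) := by
    have hint : ∀ a b : ℝ, IntervalIntegrable (fun t => sin t / t) MeasureTheory.volume a b := by
      intro a b
      refine (continuous_sinc.intervalIntegrable a b).congr_ae ?_
      refine MeasureTheory.ae_restrict_of_ae ?_
      filter_upwards [MeasureTheory.Measure.ae_ne MeasureTheory.volume (0 : ℝ)] with t ht
      exact sinc_of_ne_zero ht
    refine (tendsto_integral_sin_div.sub_const (Si x)).congr fun T => ?_
    rw [hSi x, intervalIntegral.integral_interval_sub_left (hint _ _) (hint _ _)]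
  have hs := abs_integral_sin_div_sub_le hx hsin hcos hlim
  rw [hcos]
  have e : (1 / π ^ 2) * (1 + Real.eulerMascheroniConstant + Real.log x)
        - (1 / π ^ 2) * (1 + Ci x + x * (Si x - π / 2))
        - ((1 / π ^ 2) * (1 + Real.eulerMascheroniConstant + Real.log x)
          - (1 / π ^ 2) * (1 / x ^ 2)) =
      (1 / π ^ 2) * ((-Ci x - 1 / x ^ 2) + x * (π / 2 - Si x - 1 / x + 2 / x ^ 3)) := by
    field_simp; ring
  rw [e, abs_mul, abs_of_pos (by positivity : 0 < 1 / π ^ 2)]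
  refine mul_le_mul_of_nonneg_left ((abs_add_le _ _).trans ?_) (by positivity)
  rw [abs_mul, abs_of_pos hx]
  have h6 : x * (6 / x ^ 4) = 6 / x ^ 3 := by field_simp
  have h8 : 8 / x ^ 3 = 2 / x ^ 3 + 6 / x ^ 3 := by ring
  rw [h8, ← h6]
  exact add_le_add hc (mul_le_mul_of_nonneg_left hs hx.le)

/-- `L δ(0) + 2 ∑_{ℓ < L} (L - ℓ) δ(ℓ)`, the variance of the sum of `L` consecutive spacings. -/
noncomputable def spacingSumVariance (δ : ℕ → ℝ) (L : ℕ) : ℝ :=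
  (L : ℝ) * δ 0 + 2 * ∑ ℓ ∈ Finset.Ico 1 L, ((L : ℝ) - (ℓ : ℝ)) * δ ℓ

theorem spacingSumVariance_eq (δ : ℕ → ℝ) (L : ℕ) :
    spacingSumVariance δ L = L * (δ 0 + 2 * ∑ ℓ ∈ Finset.Ico 1 L, δ ℓ)
      - 2 * ∑ ℓ ∈ Finset.Ico 1 L, (ℓ : ℝ) * δ ℓ := by
  simp only [spacingSumVariance, sub_mul, Finset.sum_sub_distrib, ← Finset.mul_sum]
  ring

theorem spacingSumVariance_second_difference (δ : ℕ → ℝ) {n : ℕ} (hn : 1 ≤ n) :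
    spacingSumVariance δ n - 2 * spacingSumVariance δ (n + 1) + spacingSumVariance δ (n + 2)
      = 2 * δ (n + 1) := by
  simp only [spacingSumVariance_eq]
  rw [Finset.sum_Ico_succ_top (by lia : 1 ≤ n + 1), Finset.sum_Ico_succ_top (by lia : 1 ≤ n + 1),
    Finset.sum_Ico_succ_top hn, Finset.sum_Ico_succ_top hn]
  push_cast
  ring

/-- Limit of `W(L) - log L / π²` when `∑ δ` over all integers vanishes and `δ(ℓ) ~ -1/(2π²ℓ²)`. -/
theorem tendsto_spacingSumVariance_sub_log (δ : ℕ → ℝ) {C : ℝ}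
    (hδ : (fun ℓ : ℕ => δ ℓ + 1 / (2 * π ^ 2 * (ℓ : ℝ) ^ 2)) =o[atTop]
      fun ℓ : ℕ => ((ℓ : ℝ) ^ 2)⁻¹)
    (hsummable : Summable fun ℓ : ℕ => δ (ℓ + 1))
    (hPandey : δ 0 + 2 * ∑' ℓ : ℕ, δ (ℓ + 1) = 0)
    (hC : HasSum (fun ℓ : ℕ =>
      ((ℓ : ℝ) + 1) * (δ (ℓ + 1) + 1 / (2 * π ^ 2 * ((ℓ : ℝ) + 1) ^ 2))) C) :
    Tendsto (fun L : ℕ => spacingSumVariance δ L - 1 / π ^ 2 * log L) atTop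
      (nhds (1 / π ^ 2 - 2 * C + 1 / π ^ 2 * eulerMascheroniConstant)) := by
  have hinv : Tendsto (fun n : ℕ => (n : ℝ)⁻¹) atTop (nhds 0) :=
    tendsto_inv_atTop_nhds_zero_nat
  have hS : Tendsto (fun n : ℕ => δ 0 + 2 * ∑ ℓ ∈ Finset.Ico 1 n, δ ℓ) atTop (nhds 0) := by
    rw [← tendsto_add_atTop_iff_nat 1, ← hPandey]
    refine ((hsummable.hasSum.tendsto_sum_nat.const_mul 2).const_add (δ 0)).congr fun n => ?_
    rw [Finset.sum_Ico_eq_sum_range]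
    simp [add_comm]
  have hb := isLittleO_inv_pow_of_sub_succ (k := 1)
    (a := fun n : ℕ => (δ 0 + 2 * ∑ ℓ ∈ Finset.Ico 1 n, δ ℓ) - 1 / π ^ 2 * (n : ℝ)⁻¹) le_rfl
    (by simpa only [mul_zero, sub_zero] using hS.sub (hinv.const_mul (1 / π ^ 2))) (by
      have h3 : (fun n : ℕ => 1 / (π ^ 2 * ((n : ℝ) ^ 2 * (n + 1)))) =o[atTop]
          fun n : ℕ => ((n : ℝ) ^ 2)⁻¹ := by
        rw [isLittleO_iff_tendsto' (by
          filter_upwards [eventually_ge_atTop 1] with n hn h0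
          have : (0 : ℝ) < n := by exact_mod_cast hn
          exact absurd h0 (by positivity))]
        have hinv1 : Tendsto (fun n : ℕ => 1 / ((n : ℝ) + 1)) atTop (nhds 0) :=
          tendsto_one_div_add_atTop_nhds_zero_nat
        have := hinv1.const_mul (1 / π ^ 2)
        rw [mul_zero] at this
        refine this.congr' ?_
        filter_upwards [eventually_ge_atTop 1] with n hn
        have : (0 : ℝ) < n := by exact_mod_cast hn
        field_simp
      refine ((hδ.const_mul_left (-2)).add h3).congr' ?_ (by simp)
      filter_upwards [eventually_ge_atTop 1] with n hn
      have : (0 : ℝ) < n := by exact_mod_cast hn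
      rw [Finset.sum_Ico_succ_top hn]
      push_cast
      field_simp
      ring)
  have hnb : Tendsto (fun n : ℕ => (n : ℝ) * (δ 0 + 2 * ∑ ℓ ∈ Finset.Ico 1 n, δ ℓ)) atTop
      (nhds (1 / π ^ 2)) := by
    have h1 := hb.tendsto_div_nhds_zero.add_const (1 / π ^ 2)
    rw [zero_add] at h1
    refine h1.congr' ?_
    filter_upwards [eventually_ge_atTop 1] with n hn
    have : (0 : ℝ) < n := by exact_mod_cast hn
    field_simp
    ring
  rw [← tendsto_add_atTop_iff_nat 1] at hnb ⊢
  have hlog : Tendsto (fun n : ℕ => log ((n + 1 : ℕ) : ℝ) - log n) atTop (nhds 0) := by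
    have h1 : Tendsto (fun n : ℕ => log (1 + (n : ℝ)⁻¹)) atTop (nhds 0) := by
      have := (hinv.const_add 1).log (by norm_num)
      simpa using this
    refine h1.congr' ?_
    filter_upwards [eventually_ge_atTop 1] with n hn
    have : (0 : ℝ) < n := by exact_mod_cast hn
    rw [← log_div (by positivity) this.ne']
    congr 1
    push_cast
    field_simp
  have := ((hnb.sub (hC.tendsto_sum_nat.const_mul 2)).add
    (tendsto_harmonic_sub_log.const_mul (1 / π ^ 2))).sub (hlog.const_mul (1 / π ^ 2))
  rw [mul_zero, sub_zero] at this
  refine this.congr fun n => ?_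
  have hsum : ∑ ℓ ∈ Finset.range n,
      ((ℓ : ℝ) + 1) * (δ (ℓ + 1) + 1 / (2 * π ^ 2 * ((ℓ : ℝ) + 1) ^ 2)) =
      (∑ ℓ ∈ Finset.Ico 1 (n + 1), (ℓ : ℝ) * δ ℓ) + 1 / (2 * π ^ 2) * (harmonic n : ℝ) := by
    rw [Finset.sum_Ico_eq_sum_range, harmonic]
    push_cast
    rw [Finset.mul_sum, ← Finset.sum_add_distrib]
    refine Finset.sum_congr rfl fun ℓ _ => ?_
    rw [add_comm 1 ℓ, add_comm (1 : ℝ)]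
    have : (ℓ : ℝ) + 1 ≠ 0 := by positivity
    field_simp
  rw [hsum, spacingSumVariance_eq]
  ring

theorem isLittleO_pow_inv_iff {a : ℕ → ℝ} {k : ℕ} :
    a =o[atTop] (fun n : ℕ => ((n : ℝ) ^ k)⁻¹) ↔
      Tendsto (fun n : ℕ => (n : ℝ) ^ k * a n) atTop (nhds 0) := by
  rw [isLittleO_iff_tendsto' (by
    filter_upwards [eventually_ge_atTop 1] with n hn h0
    have : (0 : ℝ) < n := by exact_mod_cast hn
    exact absurd h0 (by positivity))]
  simp [div_eq_mul_inv, mul_comm]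

theorem tendsto_log_add_const_div_pow (c : ℝ) {k : ℕ} (hk : k ≠ 0) :
    Tendsto (fun n : ℕ => (log n + c) / (n : ℝ) ^ k) atTop (nhds 0) := by
  have h : (fun x : ℝ => log x + c) =o[atTop] fun x : ℝ => x ^ k := by
    have h1 : (fun x : ℝ => log x) =o[atTop] fun x : ℝ => x ^ k := by
      simpa using isLittleO_log_rpow_atTop (r := (k : ℝ)) (by positivity)
    refine h1.add (isLittleO_const_left.2 (Or.inr ?_))
    exact tendsto_norm_atTop_atTop.comp (tendsto_pow_atTop hk)
  exact h.tendsto_div_nhds_zero.comp tendsto_natCast_atTop_atTop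

/-- With `Si(x) = ∫₀^x (sin t)/t dt`, `Ci(x) = −lim_{T→∞} ∫_x^T (cos t)/t dt`,
`V₂(s) = (1/π²)(1 + γ + log(2πs)) − (1/π²)[cos(2πs) + Ci(2πs) + 2πs(Si(2πs) − π/2)]`, and a
sequence `δ : ℕ → ℝ` satisfying (a) `δ(ℓ) + 1/(2π²ℓ²) + (3/(2π⁴ℓ⁴))(log(2πℓ) + γ − 11/6)
 = o(ℓ⁻⁴)`, (b) `δ(0) + 2∑_{ℓ≥1} δ(ℓ) = 0`, and (c) `∑_{ℓ≥1} ℓ(δ(ℓ) + 1/(2π²ℓ²))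
 = 1/12 − log(2π)/(2π²)`, and with `W(L) = L·δ(0) + 2∑_{ℓ=1}^{L−1} (L − ℓ)δ(ℓ)`, one has,
as `L → ∞` along positive integers,
`V₂(L) − W(L) = 1/6 + (1/(2π⁴L²))(log(2πL) + γ − (π²+9)/6) + o(L⁻²)`. -/
theorem stmt_18 (Si Ci V : ℝ → ℝ)
    (hSi : ∀ x : ℝ, Si x = ∫ t in (0 : ℝ)..x, Real.sin t / t)
    (hCi : ∀ x : ℝ, 0 < x →
      Tendsto (fun T : ℝ => ∫ t in x..T, Real.cos t / t) atTop (nhds (-Ci x)))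
    (hV : ∀ s : ℝ, 0 < s →
      V s = (1 / π ^ 2) * (1 + Real.eulerMascheroniConstant + Real.log (2 * π * s))
        - (1 / π ^ 2) * (Real.cos (2 * π * s) + Ci (2 * π * s)
            + 2 * π * s * (Si (2 * π * s) - π / 2)))
    (δ : ℕ → ℝ)
    (hasymp : (fun ℓ : ℕ =>
        δ ℓ + 1 / (2 * π ^ 2 * (ℓ : ℝ) ^ 2)
          + (3 / (2 * π ^ 4 * (ℓ : ℝ) ^ 4))
            * (Real.log (2 * π * ℓ) + Real.eulerMascheroniConstant - 11 / 6))
      =o[atTop] fun ℓ : ℕ => ((ℓ : ℝ) ^ 4)⁻¹)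
    (hsummable : Summable fun ℓ : ℕ => δ (ℓ + 1))
    (hPandey : δ 0 + 2 * ∑' ℓ : ℕ, δ (ℓ + 1) = 0)
    (hsummable' : Summable fun ℓ : ℕ =>
      ((ℓ : ℝ) + 1) * (δ (ℓ + 1) + 1 / (2 * π ^ 2 * ((ℓ : ℝ) + 1) ^ 2)))
    (hrule : (∑' ℓ : ℕ, ((ℓ : ℝ) + 1) * (δ (ℓ + 1) + 1 / (2 * π ^ 2 * ((ℓ : ℝ) + 1) ^ 2)))
      = 1 / 12 - Real.log (2 * π) / (2 * π ^ 2)) :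
    (fun L : ℕ =>
        (V L - ((L : ℝ) * δ 0 + 2 * ∑ ℓ ∈ Finset.Ico 1 L, ((L : ℝ) - (ℓ : ℝ)) * δ ℓ))
          - (1 / 6 + (1 / (2 * π ^ 4 * (L : ℝ) ^ 2))
              * (Real.log (2 * π * L) + Real.eulerMascheroniConstant - (π ^ 2 + 9) / 6)))
      =o[atTop] fun L : ℕ => ((L : ℝ) ^ 2)⁻¹ := by
  have hlogmul : ∀ n : ℕ, 1 ≤ n → log (2 * π * n) = log (2 * π) + log n := fun n hn =>
    log_mul (by positivity) (by positivity)
  set γ := Real.eulerMascheroniConstant with hγ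
  set A : ℝ := 1 / π ^ 2 * (1 + γ + log (2 * π)) - 1 / 6 with hA
  set c : ℝ := log (2 * π) + γ - (π ^ 2 + 9) / 6 + 1 / 2 with hc
  set F : ℕ → ℝ := fun n => A + 1 / π ^ 2 * log n - 1 / (2 * π ^ 4) * ((log n + c) / (n : ℝ) ^ 2)
    with hF
  have hδ : (fun ℓ : ℕ => δ ℓ + 1 / (2 * π ^ 2 * (ℓ : ℝ) ^ 2)) =o[atTop]
      fun ℓ : ℕ => ((ℓ : ℝ) ^ 2)⁻¹ := by
    rw [isLittleO_pow_inv_iff] at hasymp ⊢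
    have h1 := tendsto_log_add_const_div_pow (log (2 * π) + γ - 11 / 6) (k := 2) two_ne_zero
    have h2 : Tendsto (fun n : ℕ => ((n : ℝ)⁻¹) ^ 2) atTop (nhds 0) := by
      simpa using (tendsto_inv_atTop_nhds_zero_nat (𝕜 := ℝ)).pow 2
    have h3 := (h2.mul hasymp).sub (h1.const_mul (3 / (2 * π ^ 4)))
    simp only [mul_zero, sub_zero] at h3
    refine h3.congr' ?_
    filter_upwards [eventually_ge_atTop 1] with n hn
    have : (0 : ℝ) < n := by exact_mod_cast hn
    rw [hlogmul n hn]
    field_simp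
    ring
  have hzero : Tendsto (fun n => F n - spacingSumVariance δ n) atTop (nhds 0) := by
    have h1 := tendsto_spacingSumVariance_sub_log δ hδ hsummable hPandey
      (hrule ▸ hsummable'.hasSum)
    have h2 := tendsto_log_add_const_div_pow c (k := 2) two_ne_zero
    have h3 := (((h2.const_mul (1 / (2 * π ^ 4))).const_sub A)).sub h1
    have e : A - 1 / (2 * π ^ 4) * 0 - (1 / π ^ 2 - 2 * (1 / 12 - log (2 * π) / (2 * π ^ 2))
        + 1 / π ^ 2 * Real.eulerMascheroniConstant) = 0 := by
      rw [hA, hγ]; field_simp; ring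
    rw [e] at h3
    refine h3.congr fun n => ?_
    simp only [hF]
    ring
  have hsecond : Tendsto (fun n : ℕ => ((n + 1 : ℕ) : ℝ) ^ 4 *
      ((F n - spacingSumVariance δ n) - 2 * (F (n + 1) - spacingSumVariance δ (n + 1))
        + (F (n + 2) - spacingSumVariance δ (n + 2)))) atTop (nhds 0) := by
    have h1 := tendsto_second_difference_log A c F fun n _ => rfl
    rw [isLittleO_pow_inv_iff, ← tendsto_add_atTop_iff_nat 1] at hasymp
    have h2 := (h1.sub (hasymp.const_mul 2)).sub_const (-1 / (2 * π ^ 2) + 5 / (2 * π ^ 4))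
    simp only [mul_zero, sub_zero, sub_self] at h2
    refine h2.congr' ?_
    filter_upwards [eventually_ge_atTop 1] with n hn
    have hsd := spacingSumVariance_second_difference δ hn
    have : (F n - spacingSumVariance δ n) - 2 * (F (n + 1) - spacingSumVariance δ (n + 1))
        + (F (n + 2) - spacingSumVariance δ (n + 2)) =
        (F n - 2 * F (n + 1) + F (n + 2)) - 2 * δ (n + 1) := by linarith
    rw [this, hlogmul (n + 1) (by lia), hc]
    have hx : (0 : ℝ) < ((n + 1 : ℕ) : ℝ) := by positivity
    generalize ((n + 1 : ℕ) : ℝ) = x at hx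
    field_simp
    ring
  have hsecond' : Tendsto (fun n : ℕ => (n : ℝ) ^ 4 *
      ((F n - spacingSumVariance δ n) - 2 * (F (n + 1) - spacingSumVariance δ (n + 1))
        + (F (n + 2) - spacingSumVariance δ (n + 2)))) atTop (nhds 0) := by
    refine squeeze_zero_norm (fun n => ?_) (by simpa only [norm_zero] using hsecond.norm)
    rw [norm_mul, norm_mul, norm_pow, norm_pow, RCLike.norm_natCast, RCLike.norm_natCast]
    gcongr
    lia
  have hfirst := isLittleO_inv_pow_of_sub_succ (k := 3)
    (a := fun n => (F n - spacingSumVariance δ n) - (F (n + 1) - spacingSumVariance δ (n + 1)))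
    (by lia) (by simpa using hzero.sub ((tendsto_add_atTop_iff_nat 1).2 hzero))
    (isLittleO_pow_inv_iff.2 (hsecond'.congr fun n => by ring))
  have hmain := isLittleO_inv_pow_of_sub_succ (k := 2) (by lia) hzero hfirst
  have herr : (fun L : ℕ => V L - ((1 / π ^ 2) * (1 + γ + Real.log (2 * π * L))
      - (1 / π ^ 2) * (1 / (2 * π * L) ^ 2))) =o[atTop] fun L : ℕ => ((L : ℝ) ^ 2)⁻¹ := by
    rw [isLittleO_pow_inv_iff]
    have h0 : Tendsto (fun n : ℕ => 1 / π ^ 2 * (8 / (2 * π) ^ 3) * (n : ℝ)⁻¹) atTop (nhds 0) := by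
      simpa only [mul_zero] using (tendsto_inv_atTop_nhds_zero_nat (𝕜 := ℝ)).const_mul
        (1 / π ^ 2 * (8 / (2 * π) ^ 3))
    refine squeeze_zero_norm' ?_ h0
    filter_upwards [eventually_ge_atTop 1] with n hn
    have hn0 : (0 : ℝ) < n := by exact_mod_cast hn
    rw [norm_mul, norm_pow, RCLike.norm_natCast, norm_eq_abs]
    refine (mul_le_mul_of_nonneg_left (abs_number_variance_sub_le Si Ci V hSi hCi hV hn)
      (by positivity)).trans (le_of_eq ?_)
    field_simp
  refine (herr.add hmain).congr' ?_ EventuallyEq.rfl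
  filter_upwards [eventually_ge_atTop 1] with n hn
  have hn0 : (0 : ℝ) < n := by exact_mod_cast hn
  simp only [hF, hA, hc, spacingSumVariance]
  rw [hlogmul n hn]
  field_simp
  ring
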